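/- (RIP for uniform sampling without replacement.) Let π be the uniform distribution on {1,…,n} (π_i = 1/n) and let Ω = {ω_1,…,ω_m} be m indices drawn uniformly at random from {1,…,n} WITHOUT replacement, with M ∈ ℝ^{m×n} the sampling matrix M_{ij} = 1 if j = ω_i, 0 otherwise. For any δ, ε ∈ (0,1), if m ≥ (3/δ²)(ν_π^k)² log(2k/ε), where (ν_π^k)² = n·max_{1≤i≤n}‖U_kᵀδ_i‖₂², then with probability at least 1−ε, (1−δ)‖x‖₂² ≤ (n/m)‖M x‖₂² ≤ (1+δ)‖x‖₂² for all x ∈ span(U_k). -/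

import Mathlib

open Matrix

/-- Euclidean norm of a finite real vector. -/
noncomputable def norm2 {d : ℕ} (x : Fin d → ℝ) : ℝ := Real.sqrt (∑ j, x j ^ 2)

/-- The sampling matrix `M ∈ ℝ^{m×n}` associated to drawn indices `ω`. -/
def sampMat {n m : ℕ} (ω : Fin m → Fin n) : Matrix (Fin m) (Fin n) ℝ :=
  Matrix.of fun i j => if j = ω i then 1 else 0


/-- Telescoping bound for powers. -/
lemma rip_pow_sub_pow {A : Type*} [NormedRing A] [NormOneClass A] (x y : A) (r : ℝ)
    (hr : 1 ≤ r) (hx : ‖x‖ ≤ r) (hy : ‖y‖ ≤ r) (j : ℕ) :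
    ‖x ^ j - y ^ j‖ ≤ j * r ^ j * ‖x - y‖ := by
  have hr0 : 0 ≤ r := by linarith
  induction j with
  | zero => simp
  | succ j ih =>
    have e : x ^ (j+1) - y ^ (j+1) = x ^ j * (x - y) + (x ^ j - y ^ j) * y := by
      rw [pow_succ, pow_succ]; noncomm_ring
    have hxj : ‖x ^ j‖ ≤ r ^ j := (norm_pow_le x j).trans (pow_le_pow_left₀ (norm_nonneg _) hx j)
    have h1 : ‖x ^ j * (x - y)‖ ≤ r ^ (j+1) * ‖x - y‖ := by
      refine (norm_mul_le _ _).trans ?_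
      have : r ^ j ≤ r ^ (j+1) := pow_le_pow_right₀ hr (Nat.le_succ j)
      gcongr
      exact hxj.trans this
    have h2 : ‖(x ^ j - y ^ j) * y‖ ≤ (j * r ^ j * ‖x - y‖) * r :=
      (norm_mul_le _ _).trans (by gcongr)
    rw [e]
    refine (norm_add_le _ _).trans ((add_le_add h1 h2).trans (le_of_eq ?_))
    push_cast; ring

open Filter Topology in
lemma rip_trotter_aux {A : Type*} [NormedRing A] [NormOneClass A] [NormedAlgebra ℝ A]
    (f g : ℝ → A) (C : A) (hf : HasDerivAt f C 0) (hg : HasDerivAt g C 0) (f0 : f 0 = 1)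
    (g0 : g 0 = 1) :
    Tendsto (fun n : ℕ => f ((2:ℝ)⁻¹ ^ n) ^ (2 ^ n) - g ((2:ℝ)⁻¹ ^ n) ^ (2 ^ n)) atTop (𝓝 0) := by
  have ht : Tendsto (fun n : ℕ => (2:ℝ)⁻¹ ^ n) atTop (𝓝 0) :=
    tendsto_pow_atTop_nhds_zero_of_lt_one (by norm_num) (by norm_num)
  have bd : ∀ h : ℝ → A, HasDerivAt h C 0 → h 0 = 1 →
      ∀ᶠ t in 𝓝 (0:ℝ), ‖h t‖ ≤ Real.exp ((‖C‖ + 1) * |t|) := by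
    intro h hh h0
    have := (hasDerivAt_iff_isLittleO.1 hh).def (c := 1) one_pos
    filter_upwards [this] with t ht
    simp only [sub_zero, h0, one_mul, Real.norm_eq_abs] at ht
    have e : h t = (h t - 1 - t • C) + 1 + t • C := by abel
    have : ‖h t‖ ≤ |t| + 1 + |t| * ‖C‖ := by
      rw [e]
      refine (norm_add_le _ _).trans (add_le_add ((norm_add_le _ _).trans ?_) ?_)
      · rw [norm_one]; gcongr
      · rw [norm_smul, Real.norm_eq_abs]
    refine this.trans ?_
    have := Real.add_one_le_exp ((‖C‖ + 1) * |t|)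
    linarith
  have d : HasDerivAt (fun t => f t - g t) 0 0 := by simpa using hf.fun_sub hg
  have dl := ht.eventually (bd f hf f0)
  have dg := ht.eventually (bd g hg g0)
  rw [NormedAddGroup.tendsto_nhds_zero]
  intro e he
  set K := Real.exp (‖C‖ + 1) with hK
  have hKpos : 0 < K := Real.exp_pos _
  have dd := ht.eventually ((hasDerivAt_iff_isLittleO.1 d).def (c := e / (2*K)) (by positivity))
  filter_upwards [dl, dg, dd] with n h1 h2 h3
  simp only [sub_zero, f0, g0, sub_self, smul_zero, Real.norm_eq_abs] at h3
  have habs : |(2:ℝ)⁻¹ ^ n| = (2:ℝ)⁻¹ ^ n := abs_of_pos (by positivity)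
  rw [habs] at h1 h2 h3
  have := rip_pow_sub_pow _ _ _ (Real.one_le_exp (by positivity)) h1 h2 (2 ^ n)
  refine this.trans_lt ?_
  rw [← Real.exp_nat_mul]
  have hp : ((2:ℝ) ^ n) * (2:ℝ)⁻¹ ^ n = 1 := by rw [← mul_pow]; norm_num
  have e1 : ((2 ^ n : ℕ) : ℝ) * ((‖C‖ + 1) * (2:ℝ)⁻¹ ^ n) = ‖C‖ + 1 := by
    push_cast
    linear_combination (‖C‖ + 1) * hp
  rw [e1, ← hK]
  push_cast
  calc 2 ^ n * K * ‖f (2⁻¹ ^ n) - g (2⁻¹ ^ n)‖ ≤ 2 ^ n * K * (e / (2*K) * 2⁻¹ ^ n) := by gcongr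
    _ = e / 2 * (((2:ℝ) ^ n) * (2:ℝ)⁻¹ ^ n) := by field_simp
    _ < e := by rw [hp]; linarith

open Filter Topology NormedSpace in
lemma rip_trotter {A : Type*} [NormedRing A] [NormOneClass A] [NormedAlgebra ℝ A]
    [CompleteSpace A] (a b : A) :
    Tendsto (fun n : ℕ => (exp ((2:ℝ)⁻¹ ^ n • a) * exp ((2:ℝ)⁻¹ ^ n • b)) ^ (2 ^ n)) atTop
      (𝓝 (exp (a + b))) := by
  have hd : ∀ c : A, HasDerivAt (fun t : ℝ => exp (t • c)) c 0 := by
    intro c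
    simpa using hasDerivAt_exp_smul_const c (0:ℝ)
  have := rip_trotter_aux (fun t : ℝ => exp (t • a) * exp (t • b)) (fun t : ℝ => exp (t • (a + b)))
    (a + b) (by simpa using (hd a).fun_mul (hd b)) (hd _) (by simp) (by simp)
  have h2 : ∀ n : ℕ, exp ((2:ℝ)⁻¹ ^ n • (a + b)) ^ (2 ^ n) = exp (a + b) := by
    intro n
    let : NormedAlgebra ℚ A := NormedAlgebra.restrictScalars ℚ ℝ A
    rw [← NormedSpace.exp_nsmul]
    congr 1
    rw [← Nat.cast_smul_eq_nsmul ℝ, smul_smul]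
    push_cast
    rw [← mul_pow]; norm_num
  simp only [h2] at this
  simpa using this.add_const (exp (a + b))

lemma rip_trace_nonneg {ι : Type*} [Fintype ι] (M : Matrix ι ι ℝ) : 0 ≤ trace (Mᵀ * M) := by
  simp only [trace, diag_apply, mul_apply, transpose_apply]
  exact Finset.sum_nonneg fun i _ => Finset.sum_nonneg fun j _ => mul_self_nonneg _

lemma rip_trace_cs {ι : Type*} [Fintype ι] (X Y : Matrix ι ι ℝ) :
    2 * trace (X * Y) ≤ trace (Xᵀ * X) + trace (Y * Yᵀ) := by
  have h := rip_trace_nonneg (X - Yᵀ)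
  have e : (X - Yᵀ)ᵀ * (X - Yᵀ) = Xᵀ * X - Xᵀ * Yᵀ - Y * X + Y * Yᵀ := by
    rw [transpose_sub, transpose_transpose]; noncomm_ring
  rw [e, trace_add, trace_sub, trace_sub, ← transpose_mul, trace_transpose, trace_mul_comm Y X] at h
  linarith

lemma rip_trace_cyc {ι : Type*} [Fintype ι] [DecidableEq ι] (X Y : Matrix ι ι ℝ) (N : ℕ) :
    trace ((X * Y) ^ N) = trace ((Y * X) ^ N) := by
  cases N with
  | zero => simp
  | succ N =>
    have : (X * Y) ^ (N+1) = X * ((Y * X) ^ N * Y) := by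
      induction N with
      | zero => simp
      | succ N ih => rw [pow_succ', ih, pow_succ' (Y * X)]; noncomm_ring
    rw [this, trace_mul_comm, pow_succ]
    simp [Matrix.mul_assoc]

lemma rip_trace_step {ι : Type*} [Fintype ι] [DecidableEq ι] (q : ℕ)
    (hq : ∀ A B : Matrix ι ι ℝ, Aᵀ = A → Bᵀ = B →
      trace ((A * B) ^ (2 ^ q)) ≤ trace (A ^ (2 ^ q) * B ^ (2 ^ q))) (Y : Matrix ι ι ℝ) :
    trace (((Y * Y)ᵀ * (Y * Y)) ^ (2 ^ q)) ≤ trace ((Yᵀ * Y) ^ (2 ^ (q + 1))) := by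
  have e1 : trace (((Y * Y)ᵀ * (Y * Y)) ^ (2 ^ q)) = trace (((Yᵀ * Y) * (Y * Yᵀ)) ^ (2 ^ q)) := by
    have : (Y * Y)ᵀ * (Y * Y) = Yᵀ * (Yᵀ * Y * Y) := by
      rw [transpose_mul]; noncomm_ring
    rw [this, rip_trace_cyc]
    simp [Matrix.mul_assoc]
  have sP : (Yᵀ * Y)ᵀ = Yᵀ * Y := by simp
  have sQ : (Y * Yᵀ)ᵀ = Y * Yᵀ := by simp
  have h := hq _ _ sP sQ
  have h2 := rip_trace_cs ((Yᵀ * Y) ^ (2 ^ q)) ((Y * Yᵀ) ^ (2 ^ q))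
  rw [transpose_pow, transpose_pow, sP, sQ, ← pow_add, ← pow_add, ← two_mul, ← pow_succ',
    rip_trace_cyc Y] at h2
  rw [e1]; linarith

lemma rip_trace_pow {ι : Type*} [Fintype ι] [DecidableEq ι] (j : ℕ) :
    ∀ A B : Matrix ι ι ℝ, Aᵀ = A → Bᵀ = B →
      trace ((A * B) ^ (2 ^ j)) ≤ trace (A ^ (2 ^ j) * B ^ (2 ^ j)) := by
  induction j using Nat.strong_induction_on with
  | _ j IH =>
  intro A B hA hB
  cases j with
  | zero => simp
  | succ j =>
    have chain : ∀ (Z : Matrix ι ι ℝ) (i : ℕ), i ≤ j →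
        trace (((Z ^ (2 ^ i))ᵀ * Z ^ (2 ^ i)) ^ (2 ^ (j - i))) ≤ trace ((Zᵀ * Z) ^ (2 ^ j)) := by
      intro Z i
      induction i with
      | zero => intro _; simp
      | succ i ih =>
        intro hi
        refine le_trans ?_ (ih (by omega))
        have := rip_trace_step (j - (i + 1)) (IH _ (by omega)) (Z ^ (2 ^ i))
        rw [← pow_add, ← two_mul, ← pow_succ'] at this
        rwa [show j - (i + 1) + 1 = j - i by omega] at this
    have c := chain (A * B) j le_rfl
    rw [Nat.sub_self, pow_zero, pow_one] at c
    have h1 := rip_trace_cs ((A * B) ^ (2 ^ j)) ((A * B) ^ (2 ^ j))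
    rw [trace_mul_comm _ (((A * B) ^ (2 ^ j))ᵀ), ← pow_add, ← two_mul, ← pow_succ'] at h1
    have e : trace (((A * B)ᵀ * (A * B)) ^ (2 ^ j)) = trace (((A * A) * (B * B)) ^ (2 ^ j)) := by
      rw [transpose_mul, hA, hB, show B * A * (A * B) = B * (A * A * B) by noncomm_ring,
        rip_trace_cyc]
      simp [Matrix.mul_assoc]
    have h2 := IH j (by omega) (A * A) (B * B) (by simp [hA]) (by simp [hB])
    rw [← pow_two, ← pow_two, ← pow_mul, ← pow_mul, ← pow_succ'] at h2
    rw [← pow_two, ← pow_two] at e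
    linarith

open Filter Topology NormedSpace in
open scoped Norms.Operator in
/-- Golden–Thompson inequality for real symmetric matrices. -/
lemma rip_golden_thompson {ι : Type*} [Fintype ι] [DecidableEq ι] [Nonempty ι]
    (A B : Matrix ι ι ℝ) (hA : Aᵀ = A) (hB : Bᵀ = B) :
    trace (exp (A + B)) ≤ trace (exp A * exp B) := by
  have h := rip_trotter A B
  have ht : Tendsto (fun n : ℕ => trace ((exp ((2:ℝ)⁻¹ ^ n • A) * exp ((2:ℝ)⁻¹ ^ n • B)) ^ (2 ^ n)))
      atTop (𝓝 (trace (exp (A + B)))) :=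
    ((continuous_id.matrix_trace).tendsto _).comp h
  refine le_of_tendsto' ht fun n => ?_
  have key : ∀ C : Matrix ι ι ℝ, exp ((2:ℝ)⁻¹ ^ n • C) ^ (2 ^ n) = exp C := by
    intro C
    rw [← Matrix.exp_nsmul]
    congr 1
    rw [← Nat.cast_smul_eq_nsmul ℝ, smul_smul]
    push_cast
    rw [← mul_pow]; norm_num
  have := rip_trace_pow n (exp ((2:ℝ)⁻¹ ^ n • A)) (exp ((2:ℝ)⁻¹ ^ n • B))
    (by rw [← Matrix.exp_transpose, transpose_smul, hA])
    (by rw [← Matrix.exp_transpose, transpose_smul, hB])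
  rwa [key, key] at this

open NormedSpace in
lemma rip_exp_half {ι : Type*} [Fintype ι] [DecidableEq ι] (S : Matrix ι ι ℝ) (hS : Sᵀ = S) :
    ∃ E : Matrix ι ι ℝ, Eᵀ = E ∧ exp S = E * E := by
  refine ⟨exp ((2:ℝ)⁻¹ • S), by rw [← Matrix.exp_transpose, transpose_smul, hS], ?_⟩
  rw [← Matrix.exp_add_of_commute _ _ (Commute.refl _), ← add_smul]
  norm_num

open NormedSpace in
lemma rip_exp_trace_nonneg {ι : Type*} [Fintype ι] [DecidableEq ι] (S : Matrix ι ι ℝ)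
    (hS : Sᵀ = S) : 0 ≤ trace (exp S) := by
  obtain ⟨E, hE, h⟩ := rip_exp_half S hS
  have := rip_trace_nonneg E
  rwa [hE, ← h] at this

open NormedSpace in
lemma rip_exp_trace_mid {ι : Type*} [Fintype ι] [DecidableEq ι] [Nonempty ι]
    (P Q : Matrix ι ι ℝ) (hP : Pᵀ = P) (hQ : Qᵀ = Q) :
    2 * trace (exp (P + Q)) ≤ trace (exp (P + P)) + trace (exp (Q + Q)) := by
  have h1 := rip_golden_thompson P Q hP hQ
  have h2 := rip_trace_cs (exp P) (exp Q)
  rw [← Matrix.exp_transpose, ← Matrix.exp_transpose, hP, hQ,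
    ← Matrix.exp_add_of_commute _ _ (Commute.refl _),
    ← Matrix.exp_add_of_commute _ _ (Commute.refl _)] at h2
  linarith

open NormedSpace in
open scoped Norms.Operator in
lemma rip_exp_rank_one {ι : Type*} [Fintype ι] [DecidableEq ι]
    (X : Matrix ι ι ℝ) (c : ℝ) (hc : c ≠ 0) (hX : X * X = c • X) (a : ℝ) :
    exp (a • X) = 1 + ((Real.exp (a * c) - 1) / c) • X := by
  have hp : ∀ n : ℕ, X ^ (n + 1) = c ^ n • X := by
    intro n
    induction n with
    | zero => simp
    | succ n ih => rw [pow_succ, ih, smul_mul_assoc, hX, smul_smul, ← pow_succ]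
  have h1 := exp_series_hasSum_exp' (𝕂 := ℝ) (a • X)
  have h2 : HasSum (fun n : ℕ => ((n.factorial : ℝ)⁻¹ * (a * c) ^ n)) (Real.exp (a * c)) := by
    have := exp_series_hasSum_exp' (𝕂 := ℝ) (a * c)
    rw [← Real.exp_eq_exp_ℝ] at this
    simpa using this
  have h3 := (hasSum_ite_eq (0:ℕ) (1 - c⁻¹ • X)).add (h2.smul_const (c⁻¹ • X))
  have e : (fun n : ℕ => ((n.factorial : ℝ)⁻¹) • (a • X) ^ n) = fun n : ℕ =>
      (if n = 0 then (1 - c⁻¹ • X) else 0) + ((n.factorial : ℝ)⁻¹ * (a * c) ^ n) • (c⁻¹ • X) := by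
    funext n
    cases n with
    | zero => simp
    | succ n =>
      rw [smul_pow, hp, if_neg (Nat.succ_ne_zero n), zero_add, smul_smul, smul_smul, smul_smul]
      congr 1
      field_simp
      ring
  rw [e] at h1
  refine (h1.unique h3).trans ?_
  rw [sub_div, sub_smul, smul_smul, div_eq_mul_inv, one_div]
  abel

lemma rip_exp_slope (a c R : ℝ) (hc : 0 < c) (hcR : c ≤ R) :
    (Real.exp (a * c) - 1) / c ≤ (Real.exp (a * R) - 1) / R := by
  have hR : 0 < R := hc.trans_le hcR
  have h := convexOn_exp.2 (Set.mem_univ (0:ℝ)) (Set.mem_univ (a * R))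
    (show 0 ≤ 1 - c / R by rw [sub_nonneg, div_le_one hR]; exact hcR)
    (show 0 ≤ c / R by positivity) (by ring)
  simp only [smul_eq_mul, mul_zero, zero_add, Real.exp_zero, mul_one] at h
  rw [show c / R * (a * R) = a * c by field_simp] at h
  rw [div_le_div_iff₀ hc hR]
  have := mul_le_mul_of_nonneg_right h hR.le
  have e : (1 - c / R + c / R * Real.exp (a * R)) * R = R - c + c * Real.exp (a * R) := by
    field_simp
  rw [e] at this
  linarith

open NormedSpace in
lemma rip_exp_trace_step {ι : Type*} [Fintype ι] [DecidableEq ι] [Nonempty ι]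
    (S X : Matrix ι ι ℝ) (hS : Sᵀ = S) (hXs : Xᵀ = X) (a c R : ℝ)
    (hX : X * X = c • X) (hc : 0 ≤ c) (hcR : c ≤ R) (hc0 : c = 0 → X = 0) :
    trace (exp (S + a • X)) ≤ trace (exp S) + (Real.exp (a * R) - 1) / R * trace (exp S * X) := by
  rcases hc.eq_or_lt with h0 | hpos
  · simp [hc0 h0.symm]
  have h := rip_golden_thompson S (a • X) hS (by rw [transpose_smul, hXs])
  rw [rip_exp_rank_one X c hpos.ne' hX, mul_add, mul_one, mul_smul_comm, trace_add, trace_smul,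
    smul_eq_mul] at h
  have hnn : 0 ≤ trace (exp S * X) := by
    obtain ⟨E, hE, hh⟩ := rip_exp_half S hS
    have := rip_trace_nonneg (E * X)
    rw [transpose_mul, hE, hXs, trace_mul_comm, show E * X * (X * E) = E * (X * X) * E by noncomm_ring,
      hX, mul_smul_comm, smul_mul_assoc, trace_smul, smul_eq_mul, Matrix.mul_assoc, trace_mul_comm,
      Matrix.mul_assoc, trace_mul_comm, ← hh] at this
    exact (mul_nonneg_iff_of_pos_left hpos).1 this
  have := mul_le_mul_of_nonneg_right (rip_exp_slope a c R hpos hcR) hnn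
  linarith

open Equiv in
lemma rip_perm_step {E : Type*} [AddCommGroup E] {n : ℕ} (x : Fin n → E) (G : E → ℝ)
    (conv : ∀ (σ : Perm (Fin n)) (s : Finset (Fin n)) (p q : Fin n),
      2 * G (∑ i ∈ s, x (σ i) + x (σ p) + x (σ q)) ≤
        G (∑ i ∈ s, x (σ i) + x (σ p) + x (σ p)) + G (∑ i ∈ s, x (σ i) + x (σ q) + x (σ q)))
    (j : ℕ) (hj : j < n) :
    n * ∑ σ : Perm (Fin n), G (∑ i ∈ Finset.univ.filter (fun i : Fin n => i.val < j + 1), x (σ i)) ≤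
      ∑ σ : Perm (Fin n), ∑ l, G (∑ i ∈ Finset.univ.filter (fun i : Fin n => i.val < j), x (σ i)
        + x l) := by
  set j0 : Fin n := ⟨j, hj⟩ with hj0
  have hR : ∑ σ : Perm (Fin n), ∑ l, G (∑ i ∈ Finset.univ.filter (fun i : Fin n => i.val < j),
      x (σ i) + x l) = ∑ l : Fin n, ∑ σ : Perm (Fin n),
      G (∑ i ∈ Finset.univ.filter (fun i : Fin n => i.val < j), x (σ i) + x (σ l)) := by
    conv_rhs => rw [Finset.sum_comm]
    refine Finset.sum_congr rfl fun σ _ => ?_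
    exact (Equiv.sum_comp σ (fun l => G (∑ i ∈ Finset.univ.filter (fun i : Fin n => i.val < j),
      x (σ i) + x l))).symm
  have hsucc : ∀ σ : Perm (Fin n),
      ∑ i ∈ Finset.univ.filter (fun i : Fin n => i.val < j + 1), x (σ i) =
      ∑ i ∈ Finset.univ.filter (fun i : Fin n => i.val < j), x (σ i) + x (σ j0) := by
    intro σ
    have : Finset.univ.filter (fun i : Fin n => i.val < j + 1) =
        insert j0 (Finset.univ.filter (fun i : Fin n => i.val < j)) := by
      ext i; simp [hj0, Fin.ext_iff]; omega
    rw [this, Finset.sum_insert (by simp [hj0]), add_comm]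
  rw [hR]
  have hL : ∀ l : Fin n, ∑ σ : Perm (Fin n),
      G (∑ i ∈ Finset.univ.filter (fun i : Fin n => i.val < j + 1), x (σ i)) ≤
      ∑ σ : Perm (Fin n),
      G (∑ i ∈ Finset.univ.filter (fun i : Fin n => i.val < j), x (σ i) + x (σ l)) := by
    intro l
    simp only [hsucc]
    by_cases hl : l.val < j
    · have hne : l ≠ j0 := by intro h; rw [h] at hl; simp [hj0] at hl
      set s := (Finset.univ.filter (fun i : Fin n => i.val < j)).erase l with hs
      have hsplit : ∀ σ : Perm (Fin n),
          ∑ i ∈ Finset.univ.filter (fun i : Fin n => i.val < j), x (σ i) =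
          ∑ i ∈ s, x (σ i) + x (σ l) := by
        intro σ
        rw [hs, Finset.sum_erase_add _ _ (by simp [hl])]
      simp only [hsplit]
      have hsw : ∑ σ : Perm (Fin n), G (∑ i ∈ s, x (σ i) + x (σ j0) + x (σ j0)) =
          ∑ σ : Perm (Fin n), G (∑ i ∈ s, x (σ i) + x (σ l) + x (σ l)) := by
        rw [← Equiv.sum_comp (Equiv.mulRight (swap l j0))]
        refine Finset.sum_congr rfl fun σ _ => ?_
        have : ∑ i ∈ s, x ((σ * swap l j0) i) = ∑ i ∈ s, x (σ i) := by
          refine Finset.sum_congr rfl fun i hi => ?_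
          have h1 : i ≠ l := Finset.ne_of_mem_erase hi
          have h2 : i ≠ j0 := by
            intro h; have := Finset.mem_of_mem_erase hi; rw [h] at this; simp [hj0] at this
          rw [Perm.mul_apply, swap_apply_of_ne_of_ne h1 h2]
        simp only [Equiv.coe_mulRight, this]
        simp [Perm.mul_apply]
      have := Finset.sum_le_sum fun σ (_ : σ ∈ (Finset.univ : Finset (Perm (Fin n)))) => conv σ s l j0
      rw [← Finset.mul_sum, Finset.sum_add_distrib, hsw] at this
      linarith
    · refine le_of_eq ?_
      rw [← Equiv.sum_comp (Equiv.mulRight (swap l j0))]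
      refine Finset.sum_congr rfl fun σ _ => ?_
      have : ∑ i ∈ Finset.univ.filter (fun i : Fin n => i.val < j), x ((σ * swap l j0) i) =
          ∑ i ∈ Finset.univ.filter (fun i : Fin n => i.val < j), x (σ i) := by
        refine Finset.sum_congr rfl fun i hi => ?_
        have hi' : i.val < j := by simpa using hi
        have h1 : i ≠ l := by rintro rfl; exact hl hi'
        have h2 : i ≠ j0 := by rintro rfl; simp [hj0] at hi'
        rw [Perm.mul_apply, swap_apply_of_ne_of_ne h1 h2]
      simp only [Equiv.coe_mulRight, this]
      simp [Perm.mul_apply]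
  have := Finset.sum_le_sum fun l (_ : l ∈ (Finset.univ : Finset (Fin n))) => hL l
  simpa using this

open NormedSpace in
lemma rip_exp_trace_ge {ι : Type*} [Fintype ι] [DecidableEq ι] (H : Matrix ι ι ℝ) (hH : Hᵀ = H)
    (q : ℝ) (v : ι → ℝ) (hv : v ≠ 0) (h : q * (v ⬝ᵥ v) ≤ v ⬝ᵥ (H *ᵥ v)) :
    Real.exp q ≤ trace (exp H) := by
  have hH' : H.IsHermitian := by rw [IsHermitian, conjTranspose_eq_transpose_of_trivial, hH]
  set U : Matrix ι ι ℝ := (hH'.eigenvectorUnitary : Matrix ι ι ℝ) with hU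
  have hUU : U * Uᵀ = 1 := by
    have := Unitary.mul_star_self_of_mem hH'.eigenvectorUnitary.2
    rwa [star_eq_conjTranspose, conjTranspose_eq_transpose_of_trivial] at this
  have hUU' : Uᵀ * U = 1 := mul_eq_one_comm.1 hUU
  set d := hH'.eigenvalues with hd
  have hs : H = U * diagonal d * Uᵀ := by
    have := hH'.spectral_theorem
    rw [Unitary.conjStarAlgAut_apply, star_eq_conjTranspose,
      conjTranspose_eq_transpose_of_trivial] at this
    simpa using this
  have hinv : U⁻¹ = Uᵀ := inv_eq_right_inv hUU
  have hexp : exp H = U * diagonal (exp d) * Uᵀ := by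
    rw [hs, ← hinv, Matrix.exp_conj _ _ (IsUnit.of_mul_eq_one _ hUU), Matrix.exp_diagonal]
  have htr : trace (exp H) = ∑ i, Real.exp (d i) := by
    rw [hexp, trace_mul_comm, ← Matrix.mul_assoc, hUU', Matrix.one_mul, trace_diagonal]
    refine Finset.sum_congr rfl fun i _ => ?_
    rw [Pi.coe_exp, Real.exp_eq_exp_ℝ]
  set w := Uᵀ *ᵥ v with hw
  have hvw : v = U *ᵥ w := by rw [hw, mulVec_mulVec, hUU, one_mulVec]
  have hww : v ⬝ᵥ v = ∑ i, w i * w i := by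
    have : v ⬝ᵥ v = w ⬝ᵥ w := by
      conv_rhs => rw [hw, dotProduct_mulVec, vecMul_transpose, ← hw, ← hvw]
    rw [this]; rfl
  have hwH : v ⬝ᵥ (H *ᵥ v) = ∑ i, d i * (w i * w i) := by
    have : v ⬝ᵥ (H *ᵥ v) = w ⬝ᵥ (diagonal d *ᵥ w) := by
      rw [hs, ← mulVec_mulVec, ← mulVec_mulVec, ← hw, dotProduct_mulVec, ← mulVec_transpose, ← hw]
    rw [this]
    simp only [dotProduct, mulVec_diagonal]
    exact Finset.sum_congr rfl fun i _ => by ring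
  have hex : ∃ i, q ≤ d i := by
    by_contra hcon
    push Not at hcon
    have hw0 : w ≠ 0 := by
      intro h0; apply hv; rw [hvw, h0, mulVec_zero]
    obtain ⟨i0, hi0⟩ := Function.ne_iff.1 hw0
    have : ∑ i, d i * (w i * w i) < ∑ i, q * (w i * w i) := by
      refine Finset.sum_lt_sum (fun i _ => mul_le_mul_of_nonneg_right (hcon i).le
        (mul_self_nonneg _)) ⟨i0, Finset.mem_univ _, ?_⟩
      exact mul_lt_mul_of_pos_right (hcon i0) (mul_self_pos.2 hi0)
    rw [hww, hwH, Finset.mul_sum] at h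
    linarith
  obtain ⟨i, hi⟩ := hex
  rw [htr]
  refine (Real.exp_le_exp.2 hi).trans ?_
  exact Finset.single_le_sum (f := fun i => Real.exp (d i)) (fun i _ => (Real.exp_pos _).le)
    (Finset.mem_univ i)

open NormedSpace Equiv in
lemma rip_T_bound {n k : ℕ} (hn : 0 < n) [Nonempty (Fin k)] (X : Fin n → Matrix (Fin k) (Fin k) ℝ)
    (c : Fin n → ℝ) (R : ℝ) (hs : ∀ i, (X i)ᵀ = X i) (hX : ∀ i, X i * X i = c i • X i)
    (hc : ∀ i, 0 ≤ c i) (hcR : ∀ i, c i ≤ R) (hc0 : ∀ i, c i = 0 → X i = 0)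
    (hsum : ∑ i, X i = 1) (a : ℝ) (m : ℕ) (hm : m ≤ n) :
    ∑ σ : Perm (Fin n), trace (exp (∑ i ∈ Finset.univ.filter (fun i : Fin n => i.val < m),
      a • X (σ i))) ≤ (n.factorial * k) * Real.exp (m * (((Real.exp (a * R) - 1) / R) / n)) := by
  set φ := (Real.exp (a * R) - 1) / R with hφ
  have hsym : ∀ (σ : Perm (Fin n)) (s : Finset (Fin n)),
      (∑ i ∈ s, a • X (σ i))ᵀ = ∑ i ∈ s, a • X (σ i) := by
    intro σ s
    rw [transpose_sum]
    exact Finset.sum_congr rfl fun i _ => by rw [transpose_smul, hs]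
  induction m with
  | zero => simp [Fintype.card_perm]
  | succ j ih =>
    have ih := ih (by omega)
    have h1 := rip_perm_step (fun i => a • X i) (fun M => trace (exp M)) (by
      intro σ s p q
      have h := rip_exp_trace_mid ((2:ℝ)⁻¹ • (∑ i ∈ s, a • X (σ i)) + a • X (σ p))
        ((2:ℝ)⁻¹ • (∑ i ∈ s, a • X (σ i)) + a • X (σ q))
        (by rw [transpose_add, transpose_smul, transpose_smul, hsym, hs])
        (by rw [transpose_add, transpose_smul, transpose_smul, hsym, hs])
      have e : ∀ p q : Fin n, ((2:ℝ)⁻¹ • (∑ i ∈ s, a • X (σ i)) + a • X (σ p)) +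
        ((2:ℝ)⁻¹ • (∑ i ∈ s, a • X (σ i)) + a • X (σ q)) =
        ∑ i ∈ s, a • X (σ i) + a • X (σ p) + a • X (σ q) := by
        intro p q; module
      rw [e, e, e] at h
      exact h) j (by omega)
    have h2 : ∀ σ : Perm (Fin n), ∑ l, trace (exp (
        ∑ i ∈ Finset.univ.filter (fun i : Fin n => i.val < j), a • X (σ i) + a • X l)) ≤
        n * Real.exp (φ / n) *
          trace (exp (∑ i ∈ Finset.univ.filter (fun i : Fin n => i.val < j), a • X (σ i))) := by
      intro σ
      set S := ∑ i ∈ Finset.univ.filter (fun i : Fin n => i.val < j), a • X (σ i) with hS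
      have hSs : Sᵀ = S := hsym _ _
      have hb : ∑ l, trace (exp (S + a • X l)) ≤ ∑ l, (trace (exp S) + φ * trace (exp S * X l)) :=
        Finset.sum_le_sum fun l _ => rip_exp_trace_step S (X l) hSs (hs l) a (c l) R (hX l) (hc l)
          (hcR l) (hc0 l)
      have e : ∑ l, (trace (exp S) + φ * trace (exp S * X l)) = (n + φ) * trace (exp S) := by
        have e2 : ∑ l, trace (exp S * X l) = trace (exp S) := by
          rw [← trace_sum, ← Finset.mul_sum, hsum, mul_one]
        rw [Finset.sum_add_distrib, ← Finset.mul_sum, e2]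
        simp
        ring
      rw [e] at hb
      refine hb.trans (mul_le_mul_of_nonneg_right ?_ (rip_exp_trace_nonneg S hSs))
      have hn' : (0:ℝ) < n := by exact_mod_cast hn
      have h3 := mul_le_mul_of_nonneg_left (Real.add_one_le_exp (φ / n)) hn'.le
      rw [show (n:ℝ) * (φ / n + 1) = n + φ by field_simp; ring] at h3
      exact h3
    have h4 := h1.trans (Finset.sum_le_sum fun σ _ => h2 σ)
    rw [← Finset.mul_sum, mul_assoc] at h4
    have hn' : (0:ℝ) < n := by exact_mod_cast hn
    have h5 := le_of_mul_le_mul_left h4 hn'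
    refine h5.trans ((mul_le_mul_of_nonneg_left ih (Real.exp_pos _).le).trans (le_of_eq ?_))
    rw [mul_left_comm, ← Real.exp_add]
    push_cast
    ring_nf

open NormedSpace Equiv Classical in
lemma rip_tail {n k : ℕ} (hn : 0 < n) [Nonempty (Fin k)] (X : Fin n → Matrix (Fin k) (Fin k) ℝ)
    (c : Fin n → ℝ) (R : ℝ) (hs : ∀ i, (X i)ᵀ = X i) (hX : ∀ i, X i * X i = c i • X i)
    (hc : ∀ i, 0 ≤ c i) (hcR : ∀ i, c i ≤ R) (hc0 : ∀ i, c i = 0 → X i = 0)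
    (hsum : ∑ i, X i = 1) (a q L : ℝ) (m : ℕ) (hm : m ≤ n)
    (hL : m * (((Real.exp (a * R) - 1) / R) / n) - q ≤ - L) :
    ((Finset.univ.filter fun σ : Perm (Fin n) => ∃ v : Fin k → ℝ, v ≠ 0 ∧ q * (v ⬝ᵥ v) ≤
      v ⬝ᵥ ((∑ i ∈ Finset.univ.filter (fun i : Fin n => i.val < m), a • X (σ i)) *ᵥ v)).card : ℝ)
      ≤ n.factorial * k * Real.exp (-L) := by
  have hb := rip_T_bound hn X c R hs hX hc hcR hc0 hsum a m hm
  have hsym : ∀ (σ : Perm (Fin n)) (s : Finset (Fin n)),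
      (∑ i ∈ s, a • X (σ i))ᵀ = ∑ i ∈ s, a • X (σ i) := by
    intro σ s
    rw [transpose_sum]
    exact Finset.sum_congr rfl fun i _ => by rw [transpose_smul, hs]
  set F := (Finset.univ.filter fun σ : Perm (Fin n) => ∃ v : Fin k → ℝ, v ≠ 0 ∧ q * (v ⬝ᵥ v) ≤
      v ⬝ᵥ ((∑ i ∈ Finset.univ.filter (fun i : Fin n => i.val < m), a • X (σ i)) *ᵥ v)) with hF
  have h1 : (F.card : ℝ) * Real.exp q ≤ ∑ σ : Perm (Fin n),
      trace (exp (∑ i ∈ Finset.univ.filter (fun i : Fin n => i.val < m), a • X (σ i))) := by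
    calc (F.card : ℝ) * Real.exp q = ∑ σ ∈ F, Real.exp q := by simp
      _ ≤ ∑ σ ∈ F, trace (exp (∑ i ∈ Finset.univ.filter (fun i : Fin n => i.val < m),
            a • X (σ i))) := by
          refine Finset.sum_le_sum fun σ hσ => ?_
          obtain ⟨v, hv, hq⟩ := (Finset.mem_filter.1 hσ).2
          exact rip_exp_trace_ge _ (hsym _ _) q v hv hq
      _ ≤ _ := Finset.sum_le_sum_of_subset_of_nonneg (Finset.subset_univ _)
            fun σ _ _ => rip_exp_trace_nonneg _ (hsym _ _)
  have h2 := h1.trans hb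
  have h3 : (F.card : ℝ) ≤ n.factorial * k *
      Real.exp (m * (((Real.exp (a * R) - 1) / R) / n) - q) := by
    rw [Real.exp_sub, ← mul_div_assoc, le_div_iff₀ (Real.exp_pos _)]
    exact h2
  refine h3.trans ?_
  gcongr

open Equiv Classical in
lemma rip_count {n m : ℕ} (hmn : m ≤ n) (bad : (Fin m → Fin n) → Prop) :
    n.factorial * (Finset.univ.filter fun ω : Fin m → Fin n => Function.Injective ω ∧ bad ω).card =
    (Finset.univ.filter fun ω : Fin m → Fin n => Function.Injective ω).card *
      (Finset.univ.filter fun σ : Perm (Fin n) => bad (fun i => σ (Fin.castLE hmn i))).card := by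
  have h1 : ∀ ω : Fin m → Fin n, Function.Injective ω →
      ∑ σ : Perm (Fin n), (if bad (fun i => σ (ω i)) then 1 else 0) =
      ∑ σ : Perm (Fin n), (if bad (fun i => σ (Fin.castLE hmn i)) then 1 else 0) := by
    intro ω hω
    obtain ⟨τ, hτ⟩ : ∃ τ : Perm (Fin n), ∀ i, τ (Fin.castLE hmn i) = ω i := by
      let e := (Equiv.ofInjective _ (Fin.castLE_injective hmn)).symm.trans (Equiv.ofInjective ω hω)
      refine ⟨Equiv.extendSubtype (p := fun x => x ∈ Set.range (Fin.castLE hmn))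
        (q := fun x => x ∈ Set.range ω) e, fun i => ?_⟩
      rw [Equiv.extendSubtype_apply_of_mem _ _ ⟨i, rfl⟩]
      simp only [e, Equiv.trans_apply]
      rw [Equiv.ofInjective_symm_apply (Fin.castLE_injective hmn) i]
      rfl
    rw [← Equiv.sum_comp (Equiv.mulRight τ) (fun σ : Perm (Fin n) =>
      if bad (fun i => σ (Fin.castLE hmn i)) then 1 else 0)]
    refine Finset.sum_congr rfl fun σ _ => ?_
    simp [Perm.mul_apply, hτ]
  have h2 : ∀ σ : Perm (Fin n),
      ∑ ω ∈ Finset.univ.filter (fun ω : Fin m → Fin n => Function.Injective ω),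
        (if bad (fun i => σ (ω i)) then 1 else 0) =
      (Finset.univ.filter fun ω : Fin m → Fin n => Function.Injective ω ∧ bad ω).card := by
    intro σ
    rw [← Finset.filter_filter, Finset.card_filter]
    refine Finset.sum_bij' (fun ω _ i => σ (ω i)) (fun ω _ i => σ.symm (ω i)) ?_ ?_ ?_ ?_ ?_
    · intro ω hω
      simp only [Finset.mem_filter, Finset.mem_univ, true_and] at hω ⊢
      exact σ.injective.comp hω
    · intro ω hω
      simp only [Finset.mem_filter, Finset.mem_univ, true_and] at hω ⊢
      exact σ.symm.injective.comp hω
    · intros; simp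
    · intros; simp
    · intros; rfl
  have h3 := Finset.sum_comm (s := (Finset.univ : Finset (Perm (Fin n))))
    (t := Finset.univ.filter (fun ω : Fin m → Fin n => Function.Injective ω))
    (f := fun σ ω => if bad (fun i => σ (ω i)) then 1 else 0)
  rw [Finset.sum_congr rfl fun σ _ => h2 σ,
    Finset.sum_congr rfl fun ω hω => h1 ω (Finset.mem_filter.1 hω).2] at h3
  simp only [Finset.sum_const, smul_eq_mul, Finset.card_univ, Fintype.card_perm,
    Fintype.card_fin] at h3
  rw [h3]
  congr 1
  rw [Finset.card_filter]

lemma rip_num_up (m n R δ L : ℝ) (hn : 0 < n) (hR : 0 < R) (hδ : 0 < δ) (hδ1 : δ < 1)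
    (hm : 3 / δ ^ 2 * (n * R) * L ≤ m) (hm0 : 0 ≤ m) :
    m * (((Real.exp (Real.log (1 + δ) / R * R) - 1) / R) / n) -
      Real.log (1 + δ) / R * ((1 + δ) * (m / n)) ≤ -L := by
  rw [div_mul_cancel₀ _ hR.ne', Real.exp_log (by linarith)]
  have h := Real.le_log_one_add_of_nonneg hδ.le
  set l := Real.log (1 + δ)
  have h1 : δ ^ 2 / 3 ≤ (1 + δ) * l - δ := by
    have h2 : δ ^ 2 / 3 + δ ≤ (1 + δ) * (2 * δ / (δ + 2)) := by
      rw [← mul_div_assoc, le_div_iff₀ (by linarith)]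
      nlinarith [mul_pos (mul_pos hδ hδ) (sub_pos.2 hδ1)]
    have := mul_le_mul_of_nonneg_left h (show 0 ≤ 1 + δ by linarith)
    linarith
  have e : m * ((1 + δ - 1) / R / n) - l / R * ((1 + δ) * (m / n)) =
      - (m / (n * R) * ((1 + δ) * l - δ)) := by field_simp; ring
  have h3 : m / (n * R) * (δ ^ 2 / 3) ≤ m / (n * R) * ((1 + δ) * l - δ) :=
    mul_le_mul_of_nonneg_left h1 (by positivity)
  have h4 : L ≤ m / (n * R) * (δ ^ 2 / 3) := by
    have : L = (3 / δ ^ 2 * (n * R) * L) / (n * R) * (δ ^ 2 / 3) := by field_simp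
    rw [this]; gcongr
  rw [e]; linarith

lemma rip_num_down (m n R δ L : ℝ) (hn : 0 < n) (hR : 0 < R) (hδ : 0 < δ)
    (hm : 3 / δ ^ 2 * (n * R) * L ≤ m) (hm0 : 0 ≤ m) :
    m * (((Real.exp (-(δ / R) * R) - 1) / R) / n) -
      (-(δ / R) * ((1 - δ) * (m / n))) ≤ -L := by
  rw [show -(δ / R) * R = -δ by field_simp]
  have h : Real.exp (-δ) ≤ 1 - δ + δ ^ 2 / 2 := by
    have h1 := Real.quadratic_le_exp_of_nonneg hδ.le
    rw [Real.exp_neg, inv_le_iff_one_le_mul₀ (Real.exp_pos _)]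
    have h2 : 0 ≤ 1 - δ + δ ^ 2 / 2 := by nlinarith [sq_nonneg (δ - 1)]
    have := mul_le_mul_of_nonneg_left h1 h2
    nlinarith [sq_nonneg (δ ^ 2)]
  set l := Real.exp (-δ)
  have h1 : δ ^ 2 / 3 ≤ 1 - l - δ * (1 - δ) := by nlinarith [sq_nonneg δ]
  have e : m * ((l - 1) / R / n) - (-(δ / R) * ((1 - δ) * (m / n))) =
      - (m / (n * R) * (1 - l - δ * (1 - δ))) := by field_simp; ring
  have h3 : m / (n * R) * (δ ^ 2 / 3) ≤ m / (n * R) * (1 - l - δ * (1 - δ)) :=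
    mul_le_mul_of_nonneg_left h1 (by positivity)
  have h4 : L ≤ m / (n * R) * (δ ^ 2 / 3) := by
    have : L = (3 / δ ^ 2 * (n * R) * L) / (n * R) * (δ ^ 2 / 3) := by field_simp
    rw [this]; gcongr
  rw [e]; linarith

lemma rip_norm2_sq {d : ℕ} (x : Fin d → ℝ) : norm2 x ^ 2 = ∑ j, x j ^ 2 :=
  Real.sq_sqrt (Finset.sum_nonneg fun _ _ => sq_nonneg _)

lemma rip_sum_castLE {n m : ℕ} (hmn : m ≤ n) {E : Type*} [AddCommMonoid E] (f : Fin n → E) :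
    ∑ i ∈ Finset.univ.filter (fun i : Fin n => i.val < m), f i =
      ∑ i : Fin m, f (Fin.castLE hmn i) := by
  symm
  refine Finset.sum_bij (fun i _ => Fin.castLE hmn i) ?_ ?_ ?_ ?_
  · intro i _; simp
  · intro i _ j _ h; exact Fin.castLE_injective hmn h
  · intro i hi
    have hi' : i.val < m := by simpa using hi
    exact ⟨⟨i.val, hi'⟩, Finset.mem_univ _, rfl⟩
  · intros; rfl

/- RIP for uniform sampling WITHOUT replacement: drawing `m` distinct indices uniformly
at random (all injective tuples `ω : Fin m → Fin n` equally likely), if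
`m ≥ (3/δ²)(ν_π^k)² log(2k/ε)` with `(ν_π^k)² = n · max_i ‖U_kᵀδ_i‖₂²`, then with
probability at least `1-ε` one has `(1-δ)‖x‖² ≤ (n/m)‖Mx‖² ≤ (1+δ)‖x‖²` on `span(U_k)`.
The probability is the proportion of injective tuples satisfying the event. -/
open Classical in
theorem restricted_isometry_without_replacement (n k m : ℕ) (hk : 0 < k) (hkm : k ≤ m)
    (hmn : m ≤ n)
    (Uk : Matrix (Fin n) (Fin k) ℝ) (hU : Uk.transpose * Uk = 1)
    (δ ε : ℝ) (hδ0 : 0 < δ) (hδ1 : δ < 1) (hε0 : 0 < ε) (hε1 : ε < 1)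
    (hmLB : (3 / δ ^ 2) *
        (Real.sqrt n * Finset.univ.sup' (Finset.univ_nonempty_iff.mpr ⟨⟨0, by omega⟩⟩)
          (fun i => norm2 (Uk.transpose.mulVec (Pi.single i 1)))) ^ 2 *
        Real.log (2 * k / ε) ≤ m) :
    1 - ε ≤
      ((Finset.univ.filter fun ω : Fin m → Fin n => Function.Injective ω ∧
          ∀ x : Fin n → ℝ, (∃ α : Fin k → ℝ, x = Uk.mulVec α) →
            (1 - δ) * norm2 x ^ 2 ≤ ((n : ℝ) / m) * norm2 ((sampMat ω).mulVec x) ^ 2 ∧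
            ((n : ℝ) / m) * norm2 ((sampMat ω).mulVec x) ^ 2 ≤ (1 + δ) * norm2 x ^ 2).card : ℝ)
      / ((Finset.univ.filter fun ω : Fin m → Fin n => Function.Injective ω).card : ℝ) := by
  have hn : 0 < n := by omega
  have : Nonempty (Fin k) := ⟨⟨0, hk⟩⟩
  have hm : 0 < m := by omega
  have hnR : (0:ℝ) < n := by exact_mod_cast hn
  have hmR : (0:ℝ) < m := by exact_mod_cast hm
  have hkR : (0:ℝ) < k := by exact_mod_cast hk
  set s := Finset.univ.sup' (Finset.univ_nonempty_iff.mpr ⟨⟨0, by omega⟩⟩)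
          (fun i => norm2 (Uk.transpose.mulVec (Pi.single i 1))) with hs
  set R := s ^ 2 with hRdef
  set X : Fin n → Matrix (Fin k) (Fin k) ℝ := fun i => vecMulVec (Uk i) (Uk i) with hXdef
  set c : Fin n → ℝ := fun i => Uk i ⬝ᵥ Uk i with hcdef
  have hsX : ∀ i, (X i)ᵀ = X i := fun i => by simp [hXdef, transpose_vecMulVec]
  have hXX : ∀ i, X i * X i = c i • X i := by
    intro i
    ext a b
    simp only [hXdef, hcdef, mul_apply, vecMulVec_apply, Matrix.smul_apply, smul_eq_mul, dotProduct,
      Finset.sum_mul]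
    exact Finset.sum_congr rfl fun j _ => by ring
  have hc : ∀ i, 0 ≤ c i := fun i => Finset.sum_nonneg fun j _ => mul_self_nonneg _
  have hcR : ∀ i, c i ≤ R := by
    intro i
    have h1 : norm2 (Uk.transpose.mulVec (Pi.single i 1)) ≤ s :=
      Finset.le_sup' (fun i => norm2 (Uk.transpose.mulVec (Pi.single i 1))) (Finset.mem_univ i)
    have h2 : norm2 (Uk.transpose.mulVec (Pi.single i 1)) ^ 2 = c i := by
      rw [rip_norm2_sq]
      simp [hcdef, dotProduct, pow_two]
    rw [← h2, hRdef]
    exact pow_le_pow_left₀ (Real.sqrt_nonneg _) h1 2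
  have hc0 : ∀ i, c i = 0 → X i = 0 := by
    intro i h
    have : Uk i = 0 := dotProduct_self_eq_zero.1 h
    simp [hXdef, this]
  have hsum : ∑ i, X i = 1 := by
    rw [← hU]
    ext a b
    simp [hXdef, Matrix.sum_apply, mul_apply, vecMulVec_apply]
  have hRpos : 0 < R := by
    rcases (sq_nonneg s).eq_or_lt with h | h
    · exfalso
      have h0 : ∀ i, X i = 0 := fun i => hc0 i (le_antisymm ((hcR i).trans h.symm.le) (hc i))
      rw [Finset.sum_eq_zero fun i _ => h0 i] at hsum
      exact zero_ne_one hsum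
    · exact h
  set L := Real.log (2 * k / ε) with hL
  have hmLB' : 3 / δ ^ 2 * (n * R) * L ≤ m := by
    rw [mul_pow, Real.sq_sqrt hnR.le] at hmLB
    exact hmLB
  have hexpL : k * Real.exp (-L) = ε / 2 := by
    rw [hL, Real.exp_neg, Real.exp_log (by positivity)]
    field_simp
  have hup := rip_tail hn X c R hsX hXX hc hcR hc0 hsum (Real.log (1 + δ) / R)
    (Real.log (1 + δ) / R * ((1 + δ) * (m / n))) L m hmn
    (rip_num_up m n R δ L hnR hRpos hδ0 hδ1 hmLB' hmR.le)
  have hdown := rip_tail hn X c R hsX hXX hc hcR hc0 hsum (-(δ / R))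
    (-(δ / R) * ((1 - δ) * (m / n))) L m hmn
    (rip_num_down m n R δ L hnR hRpos hδ0 hmLB' hmR.le)
  rw [mul_assoc, hexpL] at hup hdown
  set Fu := (Finset.univ.filter fun σ : Equiv.Perm (Fin n) => ∃ v : Fin k → ℝ, v ≠ 0 ∧
      Real.log (1 + δ) / R * ((1 + δ) * (m / n)) * (v ⬝ᵥ v) ≤
      v ⬝ᵥ ((∑ i ∈ Finset.univ.filter (fun i : Fin n => i.val < m),
        (Real.log (1 + δ) / R) • X (σ i)) *ᵥ v)) with hFu
  set Fd := (Finset.univ.filter fun σ : Equiv.Perm (Fin n) => ∃ v : Fin k → ℝ, v ≠ 0 ∧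
      -(δ / R) * ((1 - δ) * (m / n)) * (v ⬝ᵥ v) ≤
      v ⬝ᵥ ((∑ i ∈ Finset.univ.filter (fun i : Fin n => i.val < m),
        (-(δ / R)) • X (σ i)) *ᵥ v)) with hFd
  set good : (Fin m → Fin n) → Prop := fun ω => ∀ x : Fin n → ℝ,
    (∃ α : Fin k → ℝ, x = Uk.mulVec α) →
            (1 - δ) * norm2 x ^ 2 ≤ ((n : ℝ) / m) * norm2 ((sampMat ω).mulVec x) ^ 2 ∧
            ((n : ℝ) / m) * norm2 ((sampMat ω).mulVec x) ^ 2 ≤ (1 + δ) * norm2 x ^ 2 with hgood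
  have hx : ∀ α : Fin k → ℝ, norm2 (Uk *ᵥ α) ^ 2 = α ⬝ᵥ α := by
    intro α
    have : norm2 (Uk *ᵥ α) ^ 2 = (Uk *ᵥ α) ⬝ᵥ (Uk *ᵥ α) := by
      rw [rip_norm2_sq]; simp [dotProduct, pow_two]
    rw [this, dotProduct_mulVec, ← mulVec_transpose, mulVec_mulVec, hU, one_mulVec]
  have hquad : ∀ (a : ℝ) (σ : Equiv.Perm (Fin n)) (α : Fin k → ℝ),
      α ⬝ᵥ ((∑ i ∈ Finset.univ.filter (fun i : Fin n => i.val < m), a • X (σ i)) *ᵥ α) =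
      a * norm2 ((sampMat (fun i => σ (Fin.castLE hmn i))) *ᵥ (Uk *ᵥ α)) ^ 2 := by
    intro a σ α
    rw [rip_norm2_sq, sum_mulVec, dotProduct_sum, rip_sum_castLE hmn, Finset.mul_sum]
    refine Finset.sum_congr rfl fun i _ => ?_
    have e1 : (sampMat (fun i => σ (Fin.castLE hmn i)) *ᵥ (Uk *ᵥ α)) i =
        Uk (σ (Fin.castLE hmn i)) ⬝ᵥ α := by
      simp [sampMat, mulVec, dotProduct]
    rw [e1, smul_mulVec, dotProduct_smul, smul_eq_mul]
    simp only [hXdef]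
    rw [vecMulVec_mulVec]
    simp [dotProduct_smul, dotProduct_comm α]
    left
    ring
  have hsub : (Finset.univ.filter fun σ : Equiv.Perm (Fin n) =>
      ¬ good (fun i => σ (Fin.castLE hmn i))) ⊆ Fu ∪ Fd := by
    intro σ hσ
    have hσ := (Finset.mem_filter.1 hσ).2
    simp only [hgood] at hσ
    push Not at hσ
    obtain ⟨x, ⟨α, rfl⟩, hbad⟩ := hσ
    rw [hx] at hbad
    have hα : α ≠ 0 := by
      rintro rfl
      have h0 : norm2 ((sampMat (fun i => σ (Fin.castLE hmn i))) *ᵥ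
        (Uk *ᵥ (0 : Fin k → ℝ))) ^ 2 = 0 := by rw [rip_norm2_sq]; simp
      rw [h0] at hbad
      simp at hbad
    set T := norm2 ((sampMat (fun i => σ (Fin.castLE hmn i))) *ᵥ (Uk *ᵥ α)) ^ 2 with hT
    rw [Finset.mem_union]
    by_cases hlow : (1 - δ) * α ⬝ᵥ α ≤ (n:ℝ) / m * T
    · left
      have h := hbad hlow
      refine Finset.mem_filter.2 ⟨Finset.mem_univ _, α, hα, ?_⟩
      rw [hquad, ← hT, mul_assoc]
      refine mul_le_mul_of_nonneg_left ?_ (div_nonneg (Real.log_nonneg (by linarith)) hRpos.le)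
      have h2 := mul_le_mul_of_nonneg_left h.le (show (0:ℝ) ≤ m / n by positivity)
      rw [show (m:ℝ) / n * (n / m * T) = T by field_simp] at h2
      linarith
    · right
      push Not at hlow
      refine Finset.mem_filter.2 ⟨Finset.mem_univ _, α, hα, ?_⟩
      rw [hquad, ← hT, mul_assoc]
      have h2 := mul_le_mul_of_nonneg_left hlow.le (show (0:ℝ) ≤ m / n by positivity)
      rw [show (m:ℝ) / n * (n / m * T) = T by field_simp] at h2
      have h3 := mul_le_mul_of_nonneg_left h2 (show 0 ≤ δ / R by positivity)
      linarith
  have hbadperm : ((Finset.univ.filter fun σ : Equiv.Perm (Fin n) =>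
      ¬ good (fun i => σ (Fin.castLE hmn i))).card : ℝ) ≤ n.factorial * ε := by
    have h1 := (Finset.card_le_card hsub).trans (Finset.card_union_le _ _)
    have h2 : ((Finset.univ.filter fun σ : Equiv.Perm (Fin n) =>
      ¬ good (fun i => σ (Fin.castLE hmn i))).card : ℝ) ≤ Fu.card + Fd.card := by exact_mod_cast h1
    linarith
  have hcount := rip_count hmn (fun ω => ¬ good ω)
  have hcount' : (n.factorial : ℝ) * ((Finset.univ.filter fun ω : Fin m → Fin n =>
      Function.Injective ω ∧ ¬ good ω).card : ℝ) =
    ((Finset.univ.filter fun ω : Fin m → Fin n => Function.Injective ω).card : ℝ) *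
      ((Finset.univ.filter fun σ : Equiv.Perm (Fin n) =>
        ¬ good (fun i => σ (Fin.castLE hmn i))).card : ℝ) := by
    rw [← Nat.cast_mul, ← Nat.cast_mul]
    refine congrArg Nat.cast ?_
    convert hcount
  have hsplit : ((Finset.univ.filter fun ω : Fin m → Fin n =>
      Function.Injective ω ∧ good ω).card : ℝ) + ((Finset.univ.filter fun ω : Fin m → Fin n =>
      Function.Injective ω ∧ ¬ good ω).card : ℝ) =
      ((Finset.univ.filter fun ω : Fin m → Fin n => Function.Injective ω).card : ℝ) := by
    rw [← Finset.filter_filter, ← Finset.filter_filter]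
    exact_mod_cast Finset.card_filter_add_card_filter_not good
  have hinj : (0:ℝ) < ((Finset.univ.filter fun ω : Fin m → Fin n =>
      Function.Injective ω).card : ℝ) := by
    have : 0 < (Finset.univ.filter fun ω : Fin m → Fin n => Function.Injective ω).card :=
      Finset.card_pos.2 ⟨Fin.castLE hmn, by simp [Fin.castLE_injective]⟩
    exact_mod_cast this
  have hfac : (0:ℝ) < n.factorial := by exact_mod_cast n.factorial_pos
  rw [le_div_iff₀ hinj]
  have h5 := mul_le_mul_of_nonneg_left hbadperm hinj.le
  rw [← hcount', mul_left_comm] at h5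
  have h6 := le_of_mul_le_mul_left h5 hfac
  linarith
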